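/- Fix s ∈ {3, 4, 5}. In ℝ^{1+s} with coordinates (d, m₁, …, m_s), let G_s be the set consisting of the vectors (0, −e_i) for 1 ≤ i ≤ s, (1, e_i) for 1 ≤ i ≤ s, and (2, e_{i₁}+e_{i₂}+e_{i₃}) for all 1 ≤ i₁ < i₂ < i₃ ≤ s, where e₁, …, e_s are the standard basis vectors of the m-coordinates, and let C_s ⊆ ℝ^{1+s} be the set of all linear combinations of elements of G_s with nonnegative real coefficients. Then every vector of G_s spans an extremal ray of C_s; that is, for each v ∈ G_s, whenever x, y ∈ C_s and x + y is a nonnegative multiple of v, both x and y are nonnegative multiples of v. -/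

import Mathlib

/-- Index type for the generators of the effective cone of the blow-up of `ℙ³` along `s`
general lines: `Fin s` for the classes `Eᵢ`, another `Fin s` for the classes `H − Eᵢ`, and
3-element subsets `S ⊆ Fin s` for the classes `2H − E_{i₁} − E_{i₂} − E_{i₃}`. -/
def GenIdx (s : ℕ) := Fin s ⊕ Fin s ⊕ {S : Finset (Fin s) // S.card = 3}

/-- The generators of the effective cone in the coordinates `(d, m₁, …, m_s)` of
`ℝ^{1+s}` (coordinate `0` is `d`): `(0, −eᵢ)`, `(1, eᵢ)`, and `(2, e_{i₁}+e_{i₂}+e_{i₃})`. -/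
def gen (s : ℕ) : GenIdx s → (Fin (s + 1) → ℝ)
  | .inl i => fun t => if t = i.succ then -1 else 0
  | .inr (.inl i) => fun t => if t = 0 then 1 else if t = i.succ then 1 else 0
  | .inr (.inr S) => fun t => if t = 0 then 2 else if t ∈ S.1.image Fin.succ then 1 else 0

instance (s : ℕ) : Fintype (GenIdx s) := by unfold GenIdx; infer_instance

/-- The cone `C_s ⊆ ℝ^{1+s}` of all nonnegative linear combinations of the generators. -/
def effCone (s : ℕ) : Set (Fin (s + 1) → ℝ) :=
  {x | ∃ c : GenIdx s → ℝ, (∀ g, 0 ≤ c g) ∧ x = ∑ g, c g • gen s g}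

/-- A linear functional vanishing on the generator `g` and positive on all other generators
exposes the ray of `g`, which is therefore extremal in the cone. -/
theorem extremal_of_exposed {s : ℕ} {g : GenIdx s} (f : (Fin (s + 1) → ℝ) →ₗ[ℝ] ℝ)
    (hg : f (gen s g) = 0) (hpos : ∀ h, h ≠ g → 0 < f (gen s h)) :
    ∀ x ∈ effCone s, ∀ y ∈ effCone s,
      (∃ t : ℝ, 0 ≤ t ∧ x + y = t • gen s g) →
      (∃ t : ℝ, 0 ≤ t ∧ x = t • gen s g) ∧ (∃ t : ℝ, 0 ≤ t ∧ y = t • gen s g) := by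
  have hnonneg : ∀ h, 0 ≤ f (gen s h) := fun h => by
    by_cases e : h = g
    · rw [e, hg]
    · exact (hpos h e).le
  have hcone : ∀ x ∈ effCone s, 0 ≤ f x := by
    rintro x ⟨c, hc, rfl⟩
    simp only [map_sum, map_smul, smul_eq_mul]
    exact Finset.sum_nonneg fun h _ => mul_nonneg (hc h) (hnonneg h)
  have hface : ∀ x ∈ effCone s, f x = 0 → ∃ t : ℝ, 0 ≤ t ∧ x = t • gen s g := by
    rintro x ⟨c, hc, rfl⟩ hx
    simp only [map_sum, map_smul, smul_eq_mul] at hx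
    rw [Finset.sum_eq_zero_iff_of_nonneg fun h _ => mul_nonneg (hc h) (hnonneg h)] at hx
    refine ⟨c g, hc g, Finset.sum_eq_single g (fun h _ hne => ?_) (by simp)⟩
    rw [(mul_eq_zero.mp (hx h (Finset.mem_univ h))).resolve_right (hpos h hne).ne', zero_smul]
  rintro x hx y hy ⟨t, -, hxy⟩
  have hsum : f x + f y = 0 := by rw [← map_add, hxy, map_smul, hg, smul_zero]
  have hx0 := hcone x hx
  have hy0 := hcone y hy
  exact ⟨hface x hx (by linarith), hface y hy (by linarith)⟩

/-- The functional `(d, m) ↦ a d - ∑ⱼ mⱼ - k ∑_{j ∈ T} mⱼ`. -/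
def degreeFunctional {s : ℕ} (a k : ℝ) (T : Finset (Fin s)) : (Fin (s + 1) → ℝ) →ₗ[ℝ] ℝ :=
  a • LinearMap.proj 0 - ∑ j : Fin s, (1 + if j ∈ T then k else 0) • LinearMap.proj j.succ

theorem degreeFunctional_apply {s : ℕ} (a k : ℝ) (T : Finset (Fin s)) (x : Fin (s + 1) → ℝ) :
    degreeFunctional a k T x = a * x 0 - ∑ j : Fin s, (1 + if j ∈ T then k else 0) * x j.succ := by
  simp [degreeFunctional]

theorem degreeFunctional_inl {s : ℕ} (a k : ℝ) (T : Finset (Fin s)) (i : Fin s) :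
    degreeFunctional a k T (gen s (.inl i)) = 1 + if i ∈ T then k else 0 := by
  simp [degreeFunctional_apply, gen, (Fin.succ_ne_zero i).symm]

theorem degreeFunctional_inr_inl {s : ℕ} (a k : ℝ) (T : Finset (Fin s)) (i : Fin s) :
    degreeFunctional a k T (gen s (.inr (.inl i))) = a - (1 + if i ∈ T then k else 0) := by
  simp [degreeFunctional_apply, gen]

theorem degreeFunctional_inr_inr {s : ℕ} (a k : ℝ) (T : Finset (Fin s))
    (S : {S : Finset (Fin s) // S.card = 3}) :
    degreeFunctional a k T (gen s (.inr (.inr S))) =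
      2 * a - 3 - k * ((S.1 ∩ T).card : ℝ) := by
  simp [degreeFunctional_apply, gen, Finset.sum_add_distrib, S.2, Finset.sum_ite_mem]
  ring

/-- **Extremal rays of `Eff(X_s)`, `s = 3, 4, 5` (Corollary 5.7).**
For `s ∈ {3, 4, 5}`, every generator `gen s g` spans an extremal ray of `C_s`: whenever
`x, y ∈ C_s` and `x + y` is a nonnegative multiple of `gen s g`, both `x` and `y` are
nonnegative multiples of `gen s g`. -/
theorem extremal_rays_effective_cone (s : ℕ) (hs : s = 3 ∨ s = 4 ∨ s = 5) (g : GenIdx s) :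
    ∀ x ∈ effCone s, ∀ y ∈ effCone s,
      (∃ t : ℝ, 0 ≤ t ∧ x + y = t • gen s g) →
      (∃ t : ℝ, 0 ≤ t ∧ x = t • gen s g) ∧ (∃ t : ℝ, 0 ≤ t ∧ y = t • gen s g) := by
  rcases g with i | i | S
  · refine extremal_of_exposed (degreeFunctional 2 (-1) {i}) (by simp [degreeFunctional_inl]) ?_
    rintro (j | j | R) h
    · have hj : j ≠ i := fun e => h (by rw [e])
      simp [degreeFunctional_inl, hj]
    · rw [degreeFunctional_inr_inl]
      split_ifs <;> norm_num
    · rw [degreeFunctional_inr_inr]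
      linarith [(Nat.cast_nonneg (R.1 ∩ {i}).card : (0 : ℝ) ≤ _)]
  · refine extremal_of_exposed (degreeFunctional 4 3 {i})
      (by norm_num [degreeFunctional_inr_inl]) ?_
    rintro (j | j | R) h
    · rw [degreeFunctional_inl]
      split_ifs <;> norm_num
    · have hj : j ≠ i := fun e => h (by rw [e])
      norm_num [degreeFunctional_inr_inl, hj]
    · rw [degreeFunctional_inr_inr]
      have hc : ((R.1 ∩ {i}).card : ℝ) ≤ 1 := by
        exact_mod_cast (Finset.card_le_card Finset.inter_subset_right).trans
          (Finset.card_singleton i).le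
      linarith
  · refine extremal_of_exposed (degreeFunctional 3 1 S.1)
      (by norm_num [degreeFunctional_inr_inr, S.2]) ?_
    rintro (j | j | R) h
    · rw [degreeFunctional_inl]
      split_ifs <;> norm_num
    · rw [degreeFunctional_inr_inl]
      split_ifs <;> norm_num
    · rw [degreeFunctional_inr_inr]
      have hlt : (R.1 ∩ S.1).card < 3 := by
        by_contra! hge
        have hR : R.1 ∩ S.1 = R.1 :=
          Finset.eq_of_subset_of_card_le Finset.inter_subset_left (by rw [R.2]; exact hge)
        have hRS : R.1 = S.1 :=
          Finset.eq_of_subset_of_card_le (Finset.inter_eq_left.mp hR) (by rw [R.2, S.2])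
        exact h (by rw [Subtype.ext hRS])
      have hc : ((R.1 ∩ S.1).card : ℝ) < 3 := by exact_mod_cast hlt
      linarith
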